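/- arXiv:0903.3856 — 3 statements merged into one kernel-verified Lean document; each statement's English description precedes it below -/
import Mathlib

section
/- There is no non-constant arithmetic progression of four squares of rational numbers; that is, if a, b, c, d ∈ ℚ with a² + c² = 2b² and b² + d² = 2c², then a² = b² = c² = d². -/
lemma aux_pyth {x y z : ℤ} (h : x ^ 2 + y ^ 2 = z ^ 2) (hc : IsCoprime x y) (hx : x % 2 = 1) :
    ∃ m n : ℤ, x = m ^ 2 - n ^ 2 ∧ y = 2 * m * n ∧ z ^ 2 = (m ^ 2 + n ^ 2) ^ 2 ∧ IsCoprime m n ∧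
      (m % 2 = 0 ∧ n % 2 = 1 ∨ m % 2 = 1 ∧ n % 2 = 0) := by
  have hx0 : x ≠ 0 := by rintro rfl; simp at hx
  have hz : 0 < |z| := by
    rw [abs_pos]
    rintro rfl
    have : 0 < x ^ 2 := by positivity
    nlinarith [sq_nonneg y]
  have hp : PythagoreanTriple x y |z| := by
    unfold PythagoreanTriple
    rw [abs_mul_abs_self]
    linarith
  obtain ⟨m, n, h1, h2, h3, h4, h5, -⟩ :=
    hp.coprime_classification' (Int.isCoprime_iff_gcd_eq_one.mp hc) hx hz
  refine ⟨m, n, h1, h2, ?_, Int.isCoprime_iff_gcd_eq_one.mpr h4, h5⟩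
  rw [← h3, sq_abs]

lemma aux_cop {x y : ℤ} (h : IsCoprime x y) : IsCoprime (x ^ 2 - y ^ 2) (x * y) := by
  apply IsCoprime.symm
  apply IsCoprime.mul_left
  · have h1 : IsCoprime x (y ^ 2) := h.pow_right
    have h2 := (h1.neg_right).add_mul_left_right x
    rw [show x ^ 2 - y ^ 2 = -y ^ 2 + x * x by ring]; exact h2
  · have h1 : IsCoprime y (x ^ 2) := h.symm.pow_right
    have h2 := h1.add_mul_left_right (-y)
    rw [show x ^ 2 - y ^ 2 = x ^ 2 + y * -y by ring]; exact h2

lemma aux_three {p s q r : ℤ} (hps : IsCoprime p s) (hqr : IsCoprime q r) (hr : r ≠ 0)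
    (h : q ^ 2 * (4 * p ^ 2 + s ^ 2) = r ^ 2 * (p ^ 2 + s ^ 2)) :
    4 * p ^ 2 + s ^ 2 = r ^ 2 ∧ p ^ 2 + s ^ 2 = q ^ 2 := by
  have hd : r ^ 2 ∣ 4 * p ^ 2 + s ^ 2 :=
    (hqr.symm.pow : IsCoprime (r ^ 2) (q ^ 2)).dvd_of_dvd_mul_left ⟨_, h⟩
  obtain ⟨k, hk⟩ := hd
  have hr2 : 0 < r ^ 2 := by positivity
  have hk2 : p ^ 2 + s ^ 2 = q ^ 2 * k := by
    apply mul_left_cancel₀ hr2.ne'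
    rw [← h, hk]; ring
  have hk3 : k ∣ 3 := by
    obtain ⟨u, v, huv⟩ := (hps.pow : IsCoprime (p ^ 2) (s ^ 2))
    refine ⟨u * (r ^ 2 - q ^ 2) + v * (4 * q ^ 2 - r ^ 2), ?_⟩
    linear_combination (-3) * huv + (u - v) * hk + (4 * v - u) * hk2
  have hpos : 0 ≤ k := by
    by_contra hneg
    push Not at hneg
    have : 0 ≤ r ^ 2 * k := by rw [← hk]; positivity
    nlinarith
  have hle : k ≤ 3 := Int.le_of_dvd (by norm_num) hk3
  have hk1 : k = 1 := by
    interval_cases k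
    · omega
    · rfl
    · omega
    · exfalso
      have h3 : (p ^ 2 + s ^ 2) % 3 = 0 := by omega
      have hp3 : p % 3 = 0 ∧ s % 3 = 0 := by
        rcases (by omega : p % 3 = 0 ∨ p % 3 = 1 ∨ p % 3 = 2) with h | h | h <;>
        rcases (by omega : s % 3 = 0 ∨ s % 3 = 1 ∨ s % 3 = 2) with h' | h' | h' <;>
        simp [pow_two, Int.add_emod, Int.mul_emod, h, h'] at h3 ⊢
      have := hps.isUnit_of_dvd' (Int.dvd_of_emod_eq_zero hp3.1) (Int.dvd_of_emod_eq_zero hp3.2)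
      rw [Int.isUnit_iff] at this
      omega
  subst hk1
  constructor <;> linarith

lemma aux_core (N : ℕ) : ∀ x y z : ℤ, x.natAbs ≤ N → IsCoprime x y → x % 2 = 0 → y % 2 = 1 →
    x ^ 4 - x ^ 2 * y ^ 2 + y ^ 4 = z ^ 2 → x = 0 := by
  induction N with
  | zero => intro x y z h; intros; omega
  | succ N ih =>
    intro x y z hN hc hx hy h
    by_contra hx0
    have hy0 : y ≠ 0 := by rintro rfl; simp at hy
    obtain ⟨u, v, h1, h2, -, huv, -⟩ := aux_pyth (x := x ^ 2 - y ^ 2) (y := x * y) (z := z)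
      (by rw [← h]; ring) (aux_cop hc)
      (by simp [pow_two, Int.sub_emod, Int.mul_emod, hx, hy])
    obtain ⟨w, rfl⟩ := Int.dvd_of_emod_eq_zero hx
    have hw : w ≠ 0 := by rintro rfl; simp at hx0
    have hwy : w * y = u * v := by linarith
    obtain ⟨p, q, ⟨r, rfl⟩, ⟨s, rfl⟩, rfl⟩ := exists_dvd_and_dvd_of_dvd_mul (Dvd.intro _ hwy)
    have hyrs : y = r * s := by
      apply mul_left_cancel₀ hw
      rw [hwy]; ring
    subst hyrs
    have hps : IsCoprime p s := huv.of_mul_left_left.of_mul_right_right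
    have hqr : IsCoprime q r := huv.of_mul_left_right.of_mul_right_left.symm
    have hr0 : r ≠ 0 := left_ne_zero_of_mul hy0
    obtain ⟨e1, e2⟩ := aux_three hps hqr hr0 (by linear_combination h1)
    have hs : s % 2 = 1 := by
      rcases Int.emod_two_eq_zero_or_one s with h | h
      · simp [Int.mul_emod, h] at hy
      · exact h
    have hs2 : IsCoprime s (2 * p) := by
      apply IsCoprime.mul_right _ hps.symm
      exact ⟨1, -(s / 2), by omega⟩
    obtain ⟨m, n, f1, f2, -, hmn, hpar⟩ := aux_pyth (x := s) (y := 2 * p) (z := r)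
      (by linarith) hs2 hs
    have hp : p = m * n := by linarith
    subst hp
    have hm0 : m ≠ 0 := by rintro rfl; simp at hw
    have hn0 : n ≠ 0 := by rintro rfl; simp at hw
    have hq0 : q ≠ 0 := right_ne_zero_of_mul hw
    have em : (m ^ 4 - m ^ 2 * n ^ 2 + n ^ 4) = q ^ 2 := by
      rw [← e2, f1]; ring
    have hM : 1 ≤ m.natAbs := by omega
    have hNn : 1 ≤ n.natAbs := by omega
    have hQ : 1 ≤ q.natAbs := by omega
    simp only [Int.natAbs_mul] at hN
    have hb : m.natAbs * n.natAbs ≤ m.natAbs * n.natAbs * q.natAbs := Nat.le_mul_of_pos_right _ hQ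
    have hb1 : m.natAbs ≤ m.natAbs * n.natAbs := Nat.le_mul_of_pos_right _ hNn
    have hb2 : n.natAbs ≤ m.natAbs * n.natAbs := Nat.le_mul_of_pos_left _ hM
    have h22 : (2 : ℤ).natAbs = 2 := rfl
    rw [h22] at hN
    rcases hpar with ⟨ha, hb'⟩ | ⟨ha, hb'⟩
    · exact hm0 (ih m n q (by omega) hmn ha hb' em)
    · exact hn0 (ih n m q (by omega) hmn.symm hb' ha (by rw [← em]; ring))

lemma aux_int {x y z : ℤ} (hc : IsCoprime x y) (h : x ^ 4 - x ^ 2 * y ^ 2 + y ^ 4 = z ^ 2) :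
    x = 0 ∨ y = 0 ∨ x ^ 2 = y ^ 2 := by
  rcases Int.emod_two_eq_zero_or_one x with hx | hx <;>
  rcases Int.emod_two_eq_zero_or_one y with hy | hy
  · exfalso
    have := hc.isUnit_of_dvd' (Int.dvd_of_emod_eq_zero hx) (Int.dvd_of_emod_eq_zero hy)
    rw [Int.isUnit_iff] at this
    omega
  · exact Or.inl (aux_core _ x y z le_rfl hc hx hy h)
  · exact Or.inr (Or.inl (aux_core _ y x z le_rfl hc.symm hy hx (by rw [← h]; ring)))
  · right; right
    obtain ⟨u, v, h1, h2, h3, huv, hpar⟩ := aux_pyth (x := x * y) (y := x ^ 2 - y ^ 2) (z := z)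
      (by rw [← h]; ring) (aux_cop hc).symm
      (by simp [Int.mul_emod, hx, hy])
    have hev : (x ^ 2 + y ^ 2) % 2 = 0 := by
      simp [pow_two, Int.add_emod, Int.mul_emod, hx, hy]
    obtain ⟨t, ht⟩ := Int.dvd_of_emod_eq_zero hev
    have e : u ^ 4 - u ^ 2 * v ^ 2 + v ^ 4 = t ^ 2 := by
      have : 4 * (u ^ 4 - u ^ 2 * v ^ 2 + v ^ 4) = (2 * t) ^ 2 := by
        rw [← ht]
        have h4 : (x * y) ^ 2 = (u ^ 2 - v ^ 2) ^ 2 := by rw [h1]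
        linear_combination (-1) * h3 - h - 3 * h4
      linarith
    rcases hpar with ⟨ha, hb⟩ | ⟨ha, hb⟩
    · have := aux_core _ u v t le_rfl huv ha hb e
      subst this; linarith
    · have := aux_core _ v u t le_rfl huv.symm hb ha (by rw [← e]; ring)
      subst this; linarith

lemma aux_rat {t w : ℚ} (h : t ^ 4 - t ^ 2 + 1 = w ^ 2) : t = 0 ∨ t ^ 2 = 1 := by
  have hd : (t.den : ℚ) ≠ 0 := by exact_mod_cast t.den_nz
  have ht : t * t.den = t.num := Rat.mul_den_eq_num t
  have hsq : IsSquare (((t.num ^ 4 - t.num ^ 2 * (t.den : ℤ) ^ 2 + (t.den : ℤ) ^ 4 : ℤ)) : ℚ) := by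
    refine ⟨w * t.den ^ 2, ?_⟩
    push_cast
    rw [← ht]
    linear_combination (t.den : ℚ) ^ 4 * h
  rw [Rat.isSquare_intCast_iff] at hsq
  obtain ⟨z, hz⟩ := hsq
  have hc : IsCoprime t.num (t.den : ℤ) := by
    rw [Int.isCoprime_iff_gcd_eq_one]
    exact t.reduced
  rcases aux_int (z := z) hc (by rw [hz]; ring) with h | h | h
  · left; exact Rat.num_eq_zero.mp h
  · exfalso; exact t.den_nz (by exact_mod_cast h)
  · right
    have h' : (t.num : ℚ) ^ 2 = (t.den : ℚ) ^ 2 := by exact_mod_cast h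
    rw [← ht] at h'
    have : (t.den : ℚ) ^ 2 ≠ 0 := pow_ne_zero _ hd
    apply mul_right_cancel₀ this
    linarith

lemma aux_two {b c : ℚ} (h : c ^ 2 = 2 * b ^ 2) : b = 0 := by
  by_contra hb
  have : IsSquare (((2 : ℤ)) : ℚ) := ⟨c / b, by field_simp; push_cast; linarith⟩
  rw [Rat.isSquare_intCast_iff] at this
  obtain ⟨r, hr⟩ := this
  have h1 : r < 2 := by nlinarith
  have h2 : -2 < r := by nlinarith
  interval_cases r <;> omega

/-- There is no non-constant arithmetic progression of four rational squares. -/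
theorem stmt_8 (a b c d : ℚ) (h1 : a ^ 2 + c ^ 2 = 2 * b ^ 2)
    (h2 : b ^ 2 + d ^ 2 = 2 * c ^ 2) :
    a ^ 2 = b ^ 2 ∧ b ^ 2 = c ^ 2 ∧ c ^ 2 = d ^ 2 := by
  have key : b ^ 2 = c ^ 2 → a ^ 2 = b ^ 2 ∧ b ^ 2 = c ^ 2 ∧ c ^ 2 = d ^ 2 := fun h =>
    ⟨by linarith, h, by linarith⟩
  apply key
  by_cases hb : b = 0
  · subst hb
    nlinarith [sq_nonneg a, sq_nonneg c]
  by_cases hd : d = 0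
  · subst hd
    have := aux_two (b := c) (c := b) (by linarith)
    subst this
    linarith
  have hq : (a * c / (b * d)) ^ 4 - (a * c / (b * d)) ^ 2 + 1 =
      ((3 * b ^ 4 + d ^ 4) / (4 * (b * d) ^ 2)) ^ 2 := by
    have hc2 : c ^ 2 = (b ^ 2 + d ^ 2) / 2 := by linarith
    have ha2 : a ^ 2 = (3 * b ^ 2 - d ^ 2) / 2 := by linarith
    have e : (a * c / (b * d)) ^ 2 =
        ((3 * b ^ 2 - d ^ 2) / 2) * ((b ^ 2 + d ^ 2) / 2) / (b * d) ^ 2 := by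
      rw [div_pow, mul_pow, ha2, hc2]
    have e4 : (a * c / (b * d)) ^ 4 = ((a * c / (b * d)) ^ 2) ^ 2 := by ring
    rw [e4, e]
    field_simp
    ring
  rcases aux_rat hq with h | h
  · have hac : a * c = 0 := by
      rcases div_eq_zero_iff.mp h with h | h
      · exact h
      · exact absurd h (mul_ne_zero hb hd)
    rcases mul_eq_zero.mp hac with h | h
    · subst h
      exact absurd (aux_two (b := b) (c := c) (by linarith)) hb
    · subst h
      exact absurd (aux_two (b := b) (c := a) (by linarith)) hb
  · have h' : (a * c) ^ 2 = (b * d) ^ 2 := by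
      rw [div_pow, div_eq_one_iff_eq (pow_ne_zero _ (mul_ne_zero hb hd))] at h
      exact h
    have hbp : 0 < b ^ 2 := by positivity
    have : (b ^ 2 - c ^ 2) * (b ^ 2 + c ^ 2) = 0 := by
      have ha2 : a ^ 2 = 2 * b ^ 2 - c ^ 2 := by linarith
      have hd2 : d ^ 2 = 2 * c ^ 2 - b ^ 2 := by linarith
      rw [mul_pow, mul_pow, ha2, hd2] at h'
      linarith
    rcases mul_eq_zero.mp this with h | h
    · linarith
    · nlinarith [sq_nonneg c]
end

section
/- The only rational points on the elliptic curve y² = x(x + 3)(x - 1) are the eight points: the point at infinity, (0,0), (1,0), (-3,0), (3,6), (3,-6), (-1,2), (-1,-2). Equivalently, if x, y ∈ ℚ satisfy y² = x(x+3)(x-1), then (x,y) is one of these seven affine points. -/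
theorem descB (m n p q : ℤ) (hmn : IsCoprime m n) (h1 : p * q = m * n)
    (h2 : m ^ 2 - n ^ 2 = p ^ 2 - 4 * q ^ 2) (h0 : m * n ≠ 0) :
    ∃ a d b c : ℤ, a ^ 2 + d ^ 2 = c ^ 2 ∧ a ^ 2 + 4 * d ^ 2 = b ^ 2 ∧ m * n = a * b * c * d := by
  have hm : m ≠ 0 := left_ne_zero_of_mul h0
  have hg : 0 < Int.gcd p m := Int.gcd_pos_of_ne_zero_right _ hm
  obtain ⟨b, c, hbc, hp, hm'⟩ := Int.exists_gcd_one hg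
  set a : ℤ := (Int.gcd p m : ℤ) with ha
  have ha0 : a ≠ 0 := by rw [ha]; exact_mod_cast hg.ne'
  have hbc' : IsCoprime b c := Int.isCoprime_iff_gcd_eq_one.2 hbc
  have h3 : b * q = c * n := by
    apply mul_left_cancel₀ ha0
    rw [hp, hm'] at h1
    linear_combination h1
  have hcq : c ∣ q := hbc'.symm.dvd_of_dvd_mul_left ⟨n, h3⟩
  obtain ⟨d, rfl⟩ := hcq
  have hc0 : c ≠ 0 := by rintro rfl; simp at hm'; exact hm hm'
  have hn : n = b * d := by
    apply mul_left_cancel₀ hc0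
    linear_combination -h3
  have hb0 : b ≠ 0 := by rintro rfl; simp at hn; simp [hn] at h0
  have had : IsCoprime a d := by
    rw [hm', hn] at hmn
    exact (hmn.of_mul_left_right).of_mul_right_right
  have h4 : c ^ 2 * (a ^ 2 + 4 * d ^ 2) = b ^ 2 * (a ^ 2 + d ^ 2) := by
    rw [hp, hm', hn] at h2
    linear_combination h2
  obtain ⟨k, hk⟩ : b ^ 2 ∣ a ^ 2 + 4 * d ^ 2 :=
    (hbc'.pow (m := 2) (n := 2)).dvd_of_dvd_mul_left ⟨_, h4⟩
  have hk2 : a ^ 2 + d ^ 2 = c ^ 2 * k := by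
    apply mul_left_cancel₀ (pow_ne_zero 2 hb0)
    rw [hk] at h4
    linear_combination -h4
  have hkd : k ∣ 3 * d ^ 2 := ⟨b ^ 2 - c ^ 2, by linear_combination hk - hk2⟩
  have hka : k ∣ 3 * a ^ 2 := ⟨4 * c ^ 2 - b ^ 2, by linear_combination 4 * hk2 - hk⟩
  have hk3 : k ∣ 3 := by
    obtain ⟨s, t, hst⟩ := had.pow (m := 2) (n := 2)
    have : (3 : ℤ) = s * (3 * a ^ 2) + t * (3 * d ^ 2) := by linear_combination -3 * hst
    rw [this]
    exact dvd_add (hka.mul_left _) (hkd.mul_left _)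
  have hkpos : 0 < k := by
    have : 0 < c ^ 2 * k := by rw [← hk2]; positivity
    exact pos_of_mul_pos_right this (by positivity)
  have hk1 : k = 1 := by
    have : k ≤ 3 := Int.le_of_dvd (by norm_num) hk3
    interval_cases k
    · rfl
    · omega
    · exfalso
      have h5 : (a ^ 2 + d ^ 2) % 3 = 0 := by rw [hk2]; omega
      have h6 : a % 3 = 0 ∧ d % 3 = 0 := by
        have e1 : a % 3 = 0 ∨ a % 3 = 1 ∨ a % 3 = 2 := by omega
        have e2 : d % 3 = 0 ∨ d % 3 = 1 ∨ d % 3 = 2 := by omega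
        rcases e1 with e | e | e <;> rcases e2 with f | f | f <;>
          simp [pow_two, Int.add_emod, Int.mul_emod, e, f] at h5 ⊢
      have := had.isUnit_of_dvd' (Int.dvd_of_emod_eq_zero h6.1) (Int.dvd_of_emod_eq_zero h6.2)
      exact absurd this (by decide)
  subst hk1
  exact ⟨a, d, b, c, by linarith, by linarith, by rw [hm', hn]; ring⟩

theorem descA (N : ℕ) : ∀ u c a v : ℤ, (u * c).natAbs = N → u ^ 2 + c ^ 2 = a ^ 2 →
    u ^ 2 + 4 * c ^ 2 = v ^ 2 → u * c = 0 := by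
  induction N using Nat.strong_induction_on with
  | _ N ih =>
  intro u c a v hN h1 h2
  by_contra h0
  have hu : u ≠ 0 := left_ne_zero_of_mul h0
  have hc : c ≠ 0 := right_ne_zero_of_mul h0
  have key : ∀ u' c' a' v' k : ℤ, u * c = k * (u' * c') → 2 ≤ k.natAbs → 
      u' ^ 2 + c' ^ 2 = a' ^ 2 → u' ^ 2 + 4 * c' ^ 2 = v' ^ 2 → False := by
    intro u' c' a' v' k hk hk2 e1 e2
    have h0' : u' * c' ≠ 0 := by intro h; rw [h] at hk; simp at hk; omega
    refine h0' (ih _ ?_ u' c' a' v' rfl e1 e2)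
    rw [← hN, hk, Int.natAbs_mul k]
    have : 0 < (u' * c').natAbs := Int.natAbs_pos.2 h0'
    nlinarith
  have hgp : 0 < Int.gcd u c := Int.gcd_pos_of_ne_zero_right _ hc
  by_cases hg : Int.gcd u c = 1
  swap
  · obtain ⟨u', c', -, hu', hc'⟩ := Int.exists_gcd_one hgp
    set g : ℤ := (Int.gcd u c : ℤ) with hgdef
    have hg0 : g ≠ 0 := by rw [hgdef]; exact_mod_cast hgp.ne'
    have hga : g ∣ a := by
      rw [← Int.pow_dvd_pow_iff (n := 2) (by norm_num), ← h1]
      exact ⟨u' ^ 2 + c' ^ 2, by rw [hu', hc']; ring⟩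
    have hgv : g ∣ v := by
      rw [← Int.pow_dvd_pow_iff (n := 2) (by norm_num), ← h2]
      exact ⟨u' ^ 2 + 4 * c' ^ 2, by rw [hu', hc']; ring⟩
    obtain ⟨a', ha'⟩ := hga
    obtain ⟨v', hv'⟩ := hgv
    refine key u' c' a' v' (g ^ 2) (by rw [hu', hc']; ring) ?_ ?_ ?_
    · rw [Int.natAbs_pow, hgdef, Int.natAbs_natCast]
      have : 2 ≤ Int.gcd u c := by omega
      nlinarith
    · apply mul_left_cancel₀ (pow_ne_zero 2 hg0)
      rw [hu', hc', ha'] at h1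
      linear_combination h1
    · apply mul_left_cancel₀ (pow_ne_zero 2 hg0)
      rw [hu', hc', hv'] at h2
      linear_combination h2
  rcases Int.emod_two_eq_zero_or_one u with hu2 | hu2
  · obtain ⟨w, rfl⟩ := Int.dvd_of_emod_eq_zero hu2
    have hv2 : (2 : ℤ) ∣ v := by
      rw [← Int.pow_dvd_pow_iff (n := 2) (by norm_num), ← h2]
      exact ⟨w ^ 2 + c ^ 2, by ring⟩
    obtain ⟨v', rfl⟩ := hv2
    exact key c w v' a 2 (by ring) (by norm_num) (by linarith) (by linarith)
  have ha : a ≠ 0 := by rintro rfl; have := sq_pos_of_ne_zero hu; nlinarith [sq_nonneg c]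
  have hv : v ≠ 0 := by rintro rfl; have := sq_pos_of_ne_zero hu; nlinarith [sq_nonneg c]
  have t1 : PythagoreanTriple u c |a| := by
    unfold PythagoreanTriple; rw [abs_mul_abs_self]; linarith
  have t2 : PythagoreanTriple u (2 * c) |v| := by
    unfold PythagoreanTriple; rw [abs_mul_abs_self]; linarith
  have hcop : IsCoprime u c := Int.isCoprime_iff_gcd_eq_one.2 hg
  have hcop2 : IsCoprime u 2 := ⟨1, -(u / 2), by omega⟩
  have hg2 : Int.gcd u (2 * c) = 1 := Int.isCoprime_iff_gcd_eq_one.1 (hcop2.mul_right hcop)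
  obtain ⟨m, n, e1, e2, -, e4, e5, -⟩ := t1.coprime_classification' hg hu2 (abs_pos.2 ha)
  obtain ⟨p, q, f1, f2, -, f4, f5, -⟩ := t2.coprime_classification' hg2 hu2 (abs_pos.2 hv)
  have hc2 : c = p * q := by linarith
  have hmn : IsCoprime m n := Int.isCoprime_iff_gcd_eq_one.2 e4
  have hmn0 : m * n ≠ 0 := by intro h; apply hc; rw [e2]; linear_combination 2 * h
  have fin : ∀ a d b e : ℤ, a ^ 2 + d ^ 2 = e ^ 2 → a ^ 2 + 4 * d ^ 2 = b ^ 2 →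
      m * n = a * b * e * d → False := by
    intro a d b e g1 g2 g3
    have hk : u * c = (2 * (u * b * e)) * (a * d) := by rw [e2]; linear_combination 2 * u * g3
    refine key a d e b _ hk ?_ g1 g2
    have : u * b * e ≠ 0 := by
      intro h
      rw [h] at hk
      simp at hk
      tauto
    omega
  have sqe : ∀ z : ℤ, z % 2 = 0 → z ^ 2 % 4 = 0 := by
    intro z hz
    obtain ⟨w, rfl⟩ := Int.dvd_of_emod_eq_zero hz
    ring_nf; omega
  have sqo : ∀ z : ℤ, z % 2 = 1 → z ^ 2 % 4 = 1 := by
    intro z hz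
    obtain ⟨w, rfl⟩ : ∃ w, z = 2 * w + 1 := ⟨z / 2, by omega⟩
    ring_nf; omega
  rcases e5 with ⟨i, j⟩ | ⟨i, j⟩ <;> rcases f5 with ⟨k, l⟩ | ⟨k, l⟩
  · obtain ⟨r, rfl⟩ := Int.dvd_of_emod_eq_zero k
    obtain ⟨x1, x2, x3, x4, y1, y2, y3⟩ := descB n m q r hmn.symm (by linarith) (by linarith)
      (by rwa [mul_comm])
    exact fin x1 x2 x3 x4 y1 y2 (by linarith)
  · have := sqe _ i; have := sqo _ j; have := sqo _ k; have := sqe _ l; omega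
  · have := sqo _ i; have := sqe _ j; have := sqe _ k; have := sqo _ l; omega
  · obtain ⟨r, rfl⟩ := Int.dvd_of_emod_eq_zero l
    obtain ⟨x1, x2, x3, x4, y1, y2, y3⟩ := descB m n p r hmn (by linarith) (by linarith) hmn0
    exact fin x1 x2 x3 x4 y1 y2 y3

theorem descQ (u c a v : ℚ) (h1 : u ^ 2 + c ^ 2 = a ^ 2) (h2 : u ^ 2 + 4 * c ^ 2 = v ^ 2) :
    u * c = 0 := by
  have hu := Rat.mul_den_eq_num u
  have hc := Rat.mul_den_eq_num c
  have ha := Rat.mul_den_eq_num a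
  have hv := Rat.mul_den_eq_num v
  have nu : (u.den : ℚ) ≠ 0 := by exact_mod_cast u.den_nz
  have nc : (c.den : ℚ) ≠ 0 := by exact_mod_cast c.den_nz
  have na : (a.den : ℚ) ≠ 0 := by exact_mod_cast a.den_nz
  have nv : (v.den : ℚ) ≠ 0 := by exact_mod_cast v.den_nz
  set D : ℚ := (u.den : ℚ) * c.den * a.den * v.den with hD
  have D0 : D ≠ 0 := by positivity
  have ku : ((u.num * c.den * a.den * v.den : ℤ) : ℚ) = u * D := by
    push_cast; rw [← hu, hD]; ring
  have kc : ((c.num * u.den * a.den * v.den : ℤ) : ℚ) = c * D := by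
    push_cast; rw [← hc, hD]; ring
  have ka : ((a.num * u.den * c.den * v.den : ℤ) : ℚ) = a * D := by
    push_cast; rw [← ha, hD]; ring
  have kv : ((v.num * u.den * c.den * a.den : ℤ) : ℚ) = v * D := by
    push_cast; rw [← hv, hD]; ring
  generalize (u.num * c.den * a.den * v.den : ℤ) = U at ku
  generalize (c.num * u.den * a.den * v.den : ℤ) = C at kc
  generalize (a.num * u.den * c.den * v.den : ℤ) = A at ka
  generalize (v.num * u.den * c.den * a.den : ℤ) = V at kv
  have r1 : U ^ 2 + C ^ 2 = A ^ 2 := by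
    have : (U : ℚ) ^ 2 + C ^ 2 = A ^ 2 := by
      rw [ku, kc, ka]; linear_combination D ^ 2 * h1
    exact_mod_cast this
  have r2 : U ^ 2 + 4 * C ^ 2 = V ^ 2 := by
    have : (U : ℚ) ^ 2 + 4 * C ^ 2 = V ^ 2 := by
      rw [ku, kc, kv]; linear_combination D ^ 2 * h2
    exact_mod_cast this
  have r3 := descA _ U C A V rfl r1 r2
  have r4 : (U : ℚ) * C = 0 := by exact_mod_cast r3
  rw [ku, kc] at r4
  have : D ^ 2 * (u * c) = 0 := by linear_combination r4
  exact (mul_eq_zero.1 this).resolve_left (pow_ne_zero 2 D0)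

/-- The only affine rational points on y² = x(x + 3)(x - 1) are
(0,0), (1,0), (-3,0), (3,6), (3,-6), (-1,2), (-1,-2). -/
theorem stmt_10 (x y : ℚ) (h : y ^ 2 = x * (x + 3) * (x - 1)) :
    (x, y) ∈ ({(0, 0), (1, 0), (-3, 0), (3, 6), (3, -6), (-1, 2), (-1, -2)} :
      Set (ℚ × ℚ)) := by
  have key := descQ (x ^ 2 - 2 * x - 3) (2 * y) (x ^ 2 + 3) (x ^ 2 + 6 * x - 3)
    (by linear_combination 4 * h) (by linear_combination 16 * h)
  simp only [Set.mem_insert_iff, Set.mem_singleton_iff, Prod.mk.injEq]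
  rcases mul_eq_zero.1 key with k | k
  · have : (x - 3) * (x + 1) = 0 := by linear_combination k
    rcases mul_eq_zero.1 this with k | k
    · obtain rfl : x = 3 := by linarith
      have : (y - 6) * (y + 6) = 0 := by linear_combination h
      rcases mul_eq_zero.1 this with k | k
      · obtain rfl : y = 6 := by linarith
        simp
      · obtain rfl : y = -6 := by linarith
        simp
    · obtain rfl : x = -1 := by linarith
      have : (y - 2) * (y + 2) = 0 := by linear_combination h
      rcases mul_eq_zero.1 this with k | k
      · obtain rfl : y = 2 := by linarith
        simp
      · obtain rfl : y = -2 := by linarith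
        simp
  · obtain rfl : y = 0 := by linarith
    have : x * (x + 3) * (x - 1) = 0 := by linear_combination -h
    rcases mul_eq_zero.1 this with k | k
    · rcases mul_eq_zero.1 k with k | k
      · simp [k]
      · obtain rfl : x = -3 := by linarith
        simp
    · obtain rfl : x = 1 := by linarith
      simp
end

section
/- If x, y ∈ ℚ satisfy y² = x(x + 3)(x - 1), then x ∈ {0, 1, -3, 3, -1}; in particular x is an integer. -/
lemma key18 (a b e f : ℤ) (h1 : a * b = 2 * (e * f)) (h2 : a ^ 2 - b ^ 2 = e ^ 2 - f ^ 2)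
    (ha : a % 2 = 0) (hb : b % 2 = 1) (hef : IsCoprime e f) (h0 : a ≠ 0) :
    ∃ j g h i : ℤ, j % 2 = 1 ∧ IsCoprime j g ∧ g ≠ 0 ∧ j ^ 2 + g ^ 2 = h ^ 2 ∧
      j ^ 2 + 4 * g ^ 2 = i ^ 2 ∧ |h| < e ^ 2 + f ^ 2 := by
  obtain ⟨a1, rfl⟩ : ∃ a1, a = 2 * a1 := ⟨a / 2, by omega⟩
  have h3 : a1 * b = e * f := by linarith
  obtain ⟨g, h, ⟨i, rfl⟩, ⟨j, rfl⟩, rfl⟩ := exists_dvd_and_dvd_of_dvd_mul (Dvd.intro _ h3)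
  have hgh : g * h ≠ 0 := fun H => h0 (by rw [H]; ring)
  have hg : g ≠ 0 := left_ne_zero_of_mul hgh
  have hh : h ≠ 0 := right_ne_zero_of_mul hgh
  have hbij : b = i * j := mul_left_cancel₀ hgh (by linarith)
  subst hbij
  have hodd : Odd (i * j) := Int.odd_iff.mpr hb
  rw [Int.odd_mul] at hodd
  obtain ⟨hi, hj⟩ := hodd
  have hj0 : j ≠ 0 := by rintro rfl; simp at hj
  have hi0 : i ≠ 0 := by rintro rfl; simp at hi
  have cgj : IsCoprime g j := (hef.of_mul_left_left).of_mul_right_right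
  have cih : IsCoprime i h := (hef.of_mul_left_right).of_mul_right_left
  have e1 : g ^ 2 * (4 * h ^ 2 - i ^ 2) = j ^ 2 * (i ^ 2 - h ^ 2) := by linear_combination h2
  obtain ⟨c, hc⟩ : j ^ 2 ∣ 4 * h ^ 2 - i ^ 2 :=
    (cgj.symm.pow (m := 2) (n := 2)).dvd_of_dvd_mul_left (Dvd.intro _ e1.symm)
  have hc2 : i ^ 2 - h ^ 2 = g ^ 2 * c := by
    apply mul_left_cancel₀ (pow_ne_zero 2 hj0)
    rw [← e1, hc]; ring
  have c3 : c ∣ 3 := by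
    have d1 : c ∣ 3 * h ^ 2 := ⟨j ^ 2 + g ^ 2, by linear_combination hc + hc2⟩
    have d2 : c ∣ 3 * i ^ 2 := ⟨j ^ 2 + 4 * g ^ 2, by linear_combination hc + 4 * hc2⟩
    obtain ⟨u, v, huv⟩ := cih.pow (m := 2) (n := 2)
    have := dvd_add (d2.mul_left u) (d1.mul_left v)
    rwa [show u * (3 * i ^ 2) + v * (3 * h ^ 2) = 3 * (u * i ^ 2 + v * h ^ 2) by ring, huv,
      mul_one] at this
  have hgp : 0 < g ^ 2 := by positivity
  have hhp : 0 < h ^ 2 := by positivity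
  have hjp : 0 < j ^ 2 := by positivity
  have hip : 0 < i ^ 2 := by positivity
  have hcpos : 0 < c := by
    by_contra hneg
    push Not at hneg
    nlinarith [mul_nonneg hgp.le (neg_nonneg.mpr hneg), mul_nonneg hjp.le (neg_nonneg.mpr hneg)]
  have hcle : c ≤ 3 := Int.le_of_dvd (by norm_num) c3
  have hj4 : j ^ 2 % 4 = 1 := by
    obtain ⟨k, rfl⟩ := hj; ring_nf; omega
  have hi4 : i ^ 2 % 4 = 1 := by
    obtain ⟨k, rfl⟩ := hi; ring_nf; omega
  have hc3 : c = 3 := by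
    interval_cases c
    · omega
    · omega
    · rfl
  subst hc3
  refine ⟨j, g, h, i, Int.odd_iff.mp hj, cgj.symm, hg, by linarith, by linarith, ?_⟩
  have : |h| ≤ h ^ 2 := by
    rw [← sq_abs]; nlinarith [abs_pos.mpr hh]
  nlinarith [mul_pos hgp hip, mul_nonneg hhp.le (sub_nonneg.mpr (Int.add_one_le_iff.mpr hjp))]

lemma pyth18 (s t q : ℤ) (hs : s % 2 = 1) (hc : IsCoprime s t) (h : s ^ 2 + t ^ 2 = q ^ 2) :
    ∃ e f : ℤ, s = e ^ 2 - f ^ 2 ∧ t = 2 * (e * f) ∧ |q| = e ^ 2 + f ^ 2 ∧ IsCoprime e f ∧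
      (e % 2 = 0 ∧ f % 2 = 1 ∨ e % 2 = 1 ∧ f % 2 = 0) := by
  have hp : PythagoreanTriple s t |q| := by
    unfold PythagoreanTriple
    rw [abs_mul_abs_self]; linarith
  have hq : 0 < |q| := by
    rw [abs_pos]; rintro rfl
    have : s = 0 := by nlinarith [sq_nonneg s, sq_nonneg t]
    subst this; simp at hs
  obtain ⟨e, f, h1, h2, h3, h4, h5, -⟩ :=
    hp.coprime_classification' (Int.isCoprime_iff_gcd_eq_one.mp hc) hs hq
  exact ⟨e, f, h1, by linarith, h3, Int.isCoprime_iff_gcd_eq_one.mpr h4, h5⟩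

lemma key18' (a b e f : ℤ) (h1 : a * b = 2 * (e * f)) (h2 : a ^ 2 - b ^ 2 = e ^ 2 - f ^ 2)
    (hab : a % 2 = 0 ∧ b % 2 = 1 ∨ a % 2 = 1 ∧ b % 2 = 0) (hef : IsCoprime e f)
    (h0 : a * b ≠ 0) :
    ∃ j g h i : ℤ, j % 2 = 1 ∧ IsCoprime j g ∧ g ≠ 0 ∧ j ^ 2 + g ^ 2 = h ^ 2 ∧
      j ^ 2 + 4 * g ^ 2 = i ^ 2 ∧ |h| < e ^ 2 + f ^ 2 := by
  rcases hab with ⟨ha, hb⟩ | ⟨ha, hb⟩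
  · exact key18 a b e f h1 h2 ha hb hef (left_ne_zero_of_mul h0)
  · rw [add_comm (e ^ 2)]
    exact key18 b a f e (by linarith) (by linarith) hb ha hef.symm (right_ne_zero_of_mul h0)

lemma desc18 (n : ℕ) : ∀ s p q r : ℤ, q.natAbs = n → s % 2 = 1 → IsCoprime s p → p ≠ 0 →
    s ^ 2 + p ^ 2 = q ^ 2 → s ^ 2 + 4 * p ^ 2 = r ^ 2 → False := by
  induction n using Nat.strong_induction_on with
  | _ n ih =>
    intro s p q r hn hs hc hp h1 h2
    obtain ⟨e, f, a1, a2, a3, a4, a5⟩ := pyth18 s p q hs hc h1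
    have hc2 : IsCoprime s (2 * p) := by
      refine IsCoprime.mul_right ?_ hc
      exact ⟨1, -(s / 2), by omega⟩
    obtain ⟨a, b, b1, b2, b3, b4, b5⟩ := pyth18 s (2 * p) r hs hc2 (by linarith)
    obtain ⟨j, g, h, i, c1, c2, c3, c4, c5, c6⟩ := key18' a b e f (by linarith) (by linarith) b5 a4
      (fun H => hp (by linarith))
    rw [← a3, Int.abs_eq_natAbs, Int.abs_eq_natAbs] at c6
    exact ih h.natAbs (by omega) j g h i rfl c1 c2 c3 c4 c5

lemma quart18 (m n k : ℤ) (hc : IsCoprime m n) (h : m ^ 4 - m ^ 2 * n ^ 2 + n ^ 4 = k ^ 2)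
    (h0 : m * n ≠ 0) : m ^ 2 = n ^ 2 := by
  by_contra hne
  have hc' : IsCoprime (m ^ 2 - n ^ 2) (m * n) := by
    refine IsCoprime.mul_right ?_ ?_
    · have : IsCoprime (n ^ 2) m := hc.symm.pow_left
      have h3 := (this.neg_left).add_mul_right_left m
      rwa [show -n ^ 2 + m * m = m ^ 2 - n ^ 2 by ring] at h3
    · have : IsCoprime (m ^ 2) n := hc.pow_left
      have h3 := this.add_mul_right_left (-n)
      rwa [show m ^ 2 + -n * n = m ^ 2 - n ^ 2 by ring] at h3
  have fin : (m % 2 = 0 ∧ n % 2 = 1 ∨ m % 2 = 1 ∧ n % 2 = 0) → False := by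
    intro hpar
    have hodd : (m ^ 2 - n ^ 2) % 2 = 1 := by
      rcases hpar with ⟨x, y⟩ | ⟨x, y⟩ <;> simp [Int.sub_emod, pow_two, Int.mul_emod, x, y]
    obtain ⟨e, f, a1, a2, a3, a4, a5⟩ := pyth18 _ _ k hodd hc' (by linarith)
    obtain ⟨j, g, h, i, c1, c2, c3, c4, c5, c6⟩ := key18' m n e f a2 a1 hpar a4 h0
    exact desc18 _ j g h i rfl c1 c2 c3 c4 c5
  rcases Int.emod_two_eq_zero_or_one m with hm | hm <;>
    rcases Int.emod_two_eq_zero_or_one n with hn | hn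
  · have := hc.isUnit_of_dvd' (Int.dvd_of_emod_eq_zero hm) (Int.dvd_of_emod_eq_zero hn)
    simp [Int.isUnit_iff] at this
  · exact fin (Or.inl ⟨hm, hn⟩)
  · exact fin (Or.inr ⟨hm, hn⟩)
  · obtain ⟨u, hu⟩ : ∃ u, m = n + 2 * u := ⟨(m - n) / 2, by omega⟩
    have hp : m ^ 2 - n ^ 2 = 2 * (2 * u * n + 2 * u ^ 2) := by subst hu; ring
    refine desc18 _ (m * n) (2 * u * n + 2 * u ^ 2) (n ^ 2 + (2 * u * n + 2 * u ^ 2)) k rfl ?_ ?_ ?_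
      ?_ ?_
    · simp [Int.mul_emod, hm, hn]
    · rw [hp] at hc'
      exact hc'.of_mul_left_right.symm
    · intro H; rw [H] at hp; exact hne (by linarith)
    · subst hu; ring
    · rw [← h]
      subst hu; ring

/-- If x, y ∈ ℚ satisfy y² = x(x + 3)(x - 1), then x ∈ {0, 1, -3, 3, -1};
in particular x is an integer. -/
theorem stmt_18 (x y : ℚ) (h : y ^ 2 = x * (x + 3) * (x - 1)) :
    x ∈ ({0, 1, -3, 3, -1} : Set ℚ) ∧ ∃ n : ℤ, x = (n : ℚ) := by
  have main : x = 0 ∨ x = 1 ∨ x = -3 ∨ x = 3 ∨ x = -1 := by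
    by_cases hx : x = 0
    · exact Or.inl hx
    by_cases hy : y = 0
    · rw [hy] at h
      have h' : x * (x + 3) * (x - 1) = 0 := by rw [← h]; ring
      rcases mul_eq_zero.mp h' with h' | h'
      · rcases mul_eq_zero.mp h' with h' | h'
        · exact Or.inl h'
        · right; right; left; linarith
      · right; left; linarith
    obtain ⟨s, hs⟩ : ∃ s : ℚ, s = y / (2 * x) := ⟨_, rfl⟩
    have hs0 : s ≠ 0 := by rw [hs]; positivity
    have hys : y = 2 * x * s := by rw [hs]; field_simp
    have h4 : 4 * x * s ^ 2 = (x + 3) * (x - 1) := by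
      apply mul_left_cancel₀ hx
      rw [hys] at h; linarith
    have hq : s ^ 4 - s ^ 2 + 1 = ((x ^ 2 + 3) / (4 * x)) ^ 2 := by
      have : s ^ 2 = (x + 3) * (x - 1) / (4 * x) := by field_simp; linarith
      rw [show s ^ 4 = (s ^ 2) ^ 2 by ring, this]
      field_simp; ring
    have hd : (s.den : ℚ) ≠ 0 := by exact_mod_cast s.den_nz
    have hsd : s * s.den = s.num := Rat.mul_den_eq_num s
    obtain ⟨m, hm⟩ : ∃ m : ℤ, m = s.num := ⟨_, rfl⟩
    obtain ⟨n, hn⟩ : ∃ n : ℤ, n = (s.den : ℤ) := ⟨_, rfl⟩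
    have hsd' : s * (n : ℚ) = m := by rw [hn, hm]; exact_mod_cast hsd
    have hn0 : n ≠ 0 := by rw [hn]; exact_mod_cast s.den_nz
    have hsq : ((m ^ 4 - m ^ 2 * n ^ 2 + n ^ 4 : ℤ) : ℚ) =
        ((n : ℚ) ^ 2 * ((x ^ 2 + 3) / (4 * x))) ^ 2 := by
      rw [mul_pow, ← hq]; push_cast; rw [← hsd']; ring
    obtain ⟨k, hk⟩ : IsSquare (m ^ 4 - m ^ 2 * n ^ 2 + n ^ 4 : ℤ) := by
      rw [← Rat.isSquare_intCast_iff]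
      exact ⟨_, hsq.trans (sq _)⟩
    have hcop : IsCoprime m n := by
      rw [Int.isCoprime_iff_gcd_eq_one, hm, hn]
      exact s.reduced
    have hm0 : m ≠ 0 := by rw [hm]; simpa using hs0
    have hmn := quart18 m n k hcop (by rw [hk]; ring) (mul_ne_zero hm0 hn0)
    have hs1 : s ^ 2 = 1 := by
      have : (m : ℚ) ^ 2 = (n : ℚ) ^ 2 := by exact_mod_cast hmn
      rw [← hsd', mul_pow] at this
      have hn0' : (n : ℚ) ^ 2 ≠ 0 := by positivity
      exact mul_right_cancel₀ hn0' (by linarith)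
    rw [hs1] at h4
    have : (x - 3) * (x + 1) = 0 := by linarith
    rcases mul_eq_zero.mp this with h' | h'
    · right; right; right; left; linarith
    · right; right; right; right; linarith
  refine ⟨by simpa using main, ?_⟩
  rcases main with h | h | h | h | h
  · exact ⟨0, by simp [h]⟩
  · exact ⟨1, by simp [h]⟩
  · exact ⟨-3, by simp [h]⟩
  · exact ⟨3, by simp [h]⟩
  · exact ⟨-1, by simp [h]⟩
end
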